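/- arXiv:2203.09515 — 5 statements merged into one kernel-verified Lean document; each statement's English description precedes it below -/
import Mathlib

section
/- Let x ≥ e⁴ be real and let β ∈ (3/4, 1) satisfy 0 < (1−β)·log x < 1. Then 1 − x^{β−1}/β > 0 and ((1−β)·log(x/e))/(1 − x^{β−1}/β) ≤ e/(e−1). -/
noncomputable section

/-- On `[0, 1]` the convex function `t ↦ e⁻ᵗ` lies below its chord. -/
lemma exp_neg_le_chord {t : ℝ} (h0 : 0 ≤ t) (h1 : t ≤ 1) :
    Real.exp (-t) ≤ 1 - (1 - Real.exp (-1)) * t := by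
  have h := convexOn_exp.2 (Set.mem_univ (0 : ℝ)) (Set.mem_univ (-1 : ℝ))
    (sub_nonneg.2 h1) h0 (by ring)
  simp only [smul_eq_mul, mul_zero, zero_add, mul_neg, mul_one, Real.exp_zero] at h
  linarith

lemma exp_neg_mul_cubic_le_one {t : ℝ} (h0 : 0 ≤ t) :
    Real.exp (-t) * (1 + t + t ^ 2 / 2 + t ^ 3 / 6) ≤ 1 := by
  have h := Real.sum_le_exp_of_nonneg h0 4
  norm_num [Finset.sum_range_succ, Nat.factorial] at h
  calc Real.exp (-t) * (1 + t + t ^ 2 / 2 + t ^ 3 / 6)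
      ≤ Real.exp (-t) * Real.exp t := by gcongr
    _ = 1 := by rw [← Real.exp_add]; simp

lemma one_sub_exp_neg_one_lt : 1 - Real.exp (-1) < 0.633 := by
  have h : (0.367 : ℝ) < Real.exp (-1) := by
    rw [Real.exp_neg, lt_inv_comm₀ (by norm_num) (Real.exp_pos 1)]
    exact Real.exp_one_lt_d9.trans (by norm_num)
  linarith

lemma half_lt_one_sub_exp_neg_one : 1 / 2 < 1 - Real.exp (-1) := by
  have h : Real.exp (-1) < 1 / 2 := by
    rw [Real.exp_neg, inv_lt_comm₀ (Real.exp_pos 1) (by norm_num)]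
    exact lt_trans (by norm_num) Real.exp_one_gt_d9
  linarith

lemma exp_neg_le_quarter {t : ℝ} (h0 : 0 ≤ t) (h1 : t ≤ 1) :
    Real.exp (-t) ≤ (1 - t / 4) * (1 - (1 - Real.exp (-1)) * (t - t / 4)) := by
  have hc := one_sub_exp_neg_one_lt
  have hP : 0 < 1 + t + t ^ 2 / 2 + t ^ 3 / 6 := by positivity
  have hpoly : 1 ≤ (1 - t / 4) * (1 - 0.633 * (t - t / 4)) *
      (1 + t + t ^ 2 / 2 + t ^ 3 / 6) := by
    have h2 : t ^ 2 ≤ t := by nlinarith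
    have h3 : t ^ 3 ≤ t := by nlinarith
    have h4 : t ^ 4 ≤ t := by nlinarith
    have h5 : 0 ≤ t ^ 5 := by positivity
    nlinarith
  have hle : Real.exp (-t) ≤ (1 - t / 4) * (1 - 0.633 * (t - t / 4)) :=
    le_of_mul_le_mul_right ((exp_neg_mul_cubic_le_one h0).trans hpoly) hP
  refine hle.trans (mul_le_mul_of_nonneg_left ?_ (by linarith))
  nlinarith

/-- The right-hand side is concave in `d`, so it suffices to compare at `d = 0` and `d = t / 4`. -/
lemma exp_neg_le_mul {t d : ℝ} (h0 : 0 < t) (h1 : t ≤ 1) (hd : 0 ≤ d) (hdt : 4 * d ≤ t) :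
    Real.exp (-t) ≤ (1 - d) * (1 - (1 - Real.exp (-1)) * (t - d)) := by
  have hA := mul_le_mul_of_nonneg_left (exp_neg_le_chord h0.le h1) (sub_nonneg.2 hdt)
  have hB := mul_le_mul_of_nonneg_left (exp_neg_le_quarter h0.le h1)
    (by positivity : 0 ≤ 4 * d)
  have hc := half_lt_one_sub_exp_neg_one
  have hC : 0 ≤ (1 - Real.exp (-1)) * (d * (t / 4 - d) * t) :=
    mul_nonneg (by linarith) (mul_nonneg (mul_nonneg hd (by linarith)) h0.le)
  refine le_of_mul_le_mul_left ?_ h0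
  linear_combination hA + hB + hC

/-- The inequality (4.7) of Lemma 4.5: if `x ≥ e⁴`, `3/4 < β < 1` and
`0 < (1-β) log x < 1`, then `(1-β)·log(x/e)/(1 - x^{β-1}/β) ≤ e/(e-1)`. -/
theorem exceptional_zero_ratio_bound :
    ∀ x β : ℝ, Real.exp 4 ≤ x → 3 / 4 < β → β < 1 →
    0 < (1 - β) * Real.log x → (1 - β) * Real.log x < 1 →
    0 < 1 - x ^ (β - 1) / β ∧
    (1 - β) * Real.log (x / Real.exp 1) / (1 - x ^ (β - 1) / β) ≤
      Real.exp 1 / (Real.exp 1 - 1) := by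
  intro x β hx hβ hβ1 ht0 ht1
  have hxpos : 0 < x := (Real.exp_pos 4).trans_le hx
  have hβpos : 0 < β := by linarith
  have hlog : 4 ≤ Real.log x := (Real.le_log_iff_exp_le hxpos).2 hx
  have hpow : x ^ (β - 1) = Real.exp (-((1 - β) * Real.log x)) := by
    rw [Real.rpow_def_of_pos hxpos]
    ring_nf
  have hnum : (1 - β) * Real.log (x / Real.exp 1) = (1 - β) * Real.log x - (1 - β) := by
    rw [Real.log_div hxpos.ne' (Real.exp_pos 1).ne', Real.log_exp]
    ring
  have hconst : Real.exp 1 / (Real.exp 1 - 1) = (1 - Real.exp (-1))⁻¹ := by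
    rw [Real.exp_neg, ← inv_div, sub_div, div_self (Real.exp_pos 1).ne', one_div]
  have hdt : 4 * (1 - β) ≤ (1 - β) * Real.log x := by nlinarith
  rw [hpow, hnum, hconst]
  set t := (1 - β) * Real.log x
  have hc := half_lt_one_sub_exp_neg_one
  have hmain := exp_neg_le_mul ht0 ht1.le (sub_nonneg.2 hβ1.le) hdt
  have hdiv : Real.exp (-t) / β ≤ 1 - (1 - Real.exp (-1)) * (t - (1 - β)) := by
    rw [div_le_iff₀ hβpos]
    linarith
  have hnumpos : 0 < (1 - Real.exp (-1)) * (t - (1 - β)) :=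
    mul_pos (by linarith) (by linarith)
  have hden : 0 < 1 - Real.exp (-t) / β := by linarith
  refine ⟨hden, ?_⟩
  rw [div_le_iff₀ hden, ← div_eq_inv_mul, le_div_iff₀ (by linarith)]
  linarith
end
end

section
/- For x ≥ e⁴ and t ∈ (0,1], define f(x,t) = e^t·t·(log x − t)·(log x − 1)/((e^t·(log x − t) − log x)·log x). Then the denominator e^t·(log x − t) − log x is positive for all such x and t, and sup{ f(x,t) : x ≥ e⁴, t ∈ (0,1] } = e/(e−1). -/
noncomputable section

/-- The auxiliary function `f(x,t)` from the proof of Lemma 4.5. -/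
noncomputable def fKT (x t : ℝ) : ℝ :=
  Real.exp t * t * (Real.log x - t) * (Real.log x - 1) /
    ((Real.exp t * (Real.log x - t) - Real.log x) * Real.log x)

/-- A quantitative form of the convexity of `t ↦ exp (-t)` on `[0, 1]`. -/
theorem exp_neg_add_le_chord {t : ℝ} (h0 : 0 ≤ t) (h1 : t ≤ 1) :
    Real.exp (-t) + Real.exp (-1) / 4 * (t * (1 - t)) ≤ (1 - t) + t * Real.exp (-1) := by
  have hu : 0 < Real.exp (-t) := Real.exp_pos _
  have huv : Real.exp (-1) ≤ Real.exp (-t) := Real.exp_le_exp.2 (by linarith)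
  have hleft : Real.exp (-t) * (1 + t + t ^ 2 / 2) ≤ 1 := by
    have h := mul_le_mul_of_nonneg_left (Real.quadratic_le_exp_of_nonneg h0) hu.le
    rwa [← Real.exp_add, neg_add_cancel, Real.exp_zero] at h
  have hright : Real.exp (-t) * (1 - (1 - t) / 2) ^ 2 ≤ Real.exp (-1) := by
    have h : 1 - (1 - t) / 2 ≤ Real.exp (-((1 - t) / 2)) := by
      linarith [Real.add_one_le_exp (-((1 - t) / 2))]
    have hsq := pow_le_pow_left₀ (by linarith) h 2
    have heq : Real.exp (-1) = Real.exp (-t) * Real.exp (-((1 - t) / 2)) ^ 2 := by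
      rw [← Real.exp_nat_mul, ← Real.exp_add]
      congr 1
      push_cast
      ring
    rw [heq]
    exact mul_le_mul_of_nonneg_left hsq hu.le
  have hst : 0 ≤ t * (1 - t) := mul_nonneg h0 (by linarith)
  have hl := mul_le_mul_of_nonneg_left hleft (by linarith : 0 ≤ 1 - t)
  have hr := mul_le_mul_of_nonneg_left hright h0
  have hm := mul_le_mul_of_nonneg_right huv hst
  have hp : 0 ≤ Real.exp (-t) * (t * (1 - t)) * t := by positivity
  nlinarith

theorem exp_neg_one_lt_half : Real.exp (-1) < 1 / 2 := by
  rw [Real.exp_neg, inv_lt_comm₀ (Real.exp_pos _) (by norm_num)]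
  linarith [Real.exp_one_gt_d9]

theorem lt_mul_one_sub_exp_neg {L t : ℝ} (hL : 4 ≤ L) (h0 : 0 < t) (h1 : t ≤ 1) :
    t < L * (1 - Real.exp (-t)) := by
  have hc := exp_neg_add_le_chord h0.le h1
  have hv : 0 < Real.exp (-1) := Real.exp_pos _
  have hst : 0 ≤ Real.exp (-1) / 4 * (t * (1 - t)) :=
    mul_nonneg (by positivity) (mul_nonneg h0.le (by linarith))
  have ht : t * Real.exp (-1) < t * (1 / 2) := mul_lt_mul_of_pos_left exp_neg_one_lt_half h0
  nlinarith

theorem exp_mul_sub_sub_eq (L t : ℝ) :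
    Real.exp t * (L - t) - L = Real.exp t * (L * (1 - Real.exp (-t)) - t) := by
  have h : Real.exp t * Real.exp (-t) = 1 := by rw [← Real.exp_add, add_neg_cancel, Real.exp_zero]
  linear_combination L * h

theorem exp_mul_sub_sub_pos {L t : ℝ} (hL : 4 ≤ L) (h0 : 0 < t) (h1 : t ≤ 1) :
    0 < Real.exp t * (L - t) - L := by
  rw [exp_mul_sub_sub_eq]
  exact mul_pos (Real.exp_pos _) (sub_pos.2 (lt_mul_one_sub_exp_neg hL h0 h1))

theorem one_sub_exp_neg_one_mul_le {L t : ℝ} (hL : 4 ≤ L) (h0 : 0 ≤ t) (h1 : t ≤ 1) :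
    (1 - Real.exp (-1)) * (t * (L - t) * (L - 1)) ≤ (L * (1 - Real.exp (-t)) - t) * L := by
  have hc := exp_neg_add_le_chord h0 h1
  have hv : 0 < Real.exp (-1) := Real.exp_pos _
  have hd : Real.exp (-1) < 3 / 8 := by
    rw [Real.exp_neg, inv_lt_comm₀ (Real.exp_pos _) (by norm_num)]
    linarith [Real.exp_one_gt_d9]
  have hcL := mul_le_mul_of_nonneg_left hc (sq_nonneg L)
  generalize Real.exp (-1) = v at *
  generalize Real.exp (-t) = u at *
  have hzero : 0 ≤ t * (1 - t) * (v * L * (L - 4)) :=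
    mul_nonneg (mul_nonneg h0 (by linarith)) (mul_nonneg (by nlinarith) (by linarith))
  have hone : 0 ≤ t ^ 2 * (L * (1 - 2 * v) - (1 - v)) :=
    mul_nonneg (sq_nonneg t) (by nlinarith)
  nlinarith

theorem exp_one_div_exp_one_sub_one :
    Real.exp 1 / (Real.exp 1 - 1) = 1 / (1 - Real.exp (-1)) := by
  have h : 1 < Real.exp 1 := by linarith [Real.exp_one_gt_d9]
  have h' : Real.exp 1 - 1 ≠ 0 := by linarith
  rw [Real.exp_neg]
  field_simp

theorem fKT_le {x t : ℝ} (hL : 4 ≤ Real.log x) (h0 : 0 < t) (h1 : t ≤ 1) :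
    fKT x t ≤ Real.exp 1 / (Real.exp 1 - 1) := by
  have hpos := exp_mul_sub_sub_pos hL h0 h1
  have hv : 0 < 1 - Real.exp (-1) := by linarith [exp_neg_one_lt_half]
  rw [fKT, exp_one_div_exp_one_sub_one,
    div_le_div_iff₀ (mul_pos hpos (by linarith)) hv, exp_mul_sub_sub_eq]
  have h := mul_le_mul_of_nonneg_left (one_sub_exp_neg_one_mul_le hL h0.le h1)
    (Real.exp_pos t).le
  linarith

theorem le_fKT_exp_one {L : ℝ} (hL : 4 ≤ L) :
    Real.exp 1 / (Real.exp 1 - 1) * (1 - 1 / L) ≤ fKT (Real.exp L) 1 := by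
  have hpos := exp_mul_sub_sub_pos hL one_pos le_rfl
  have he : 1 < Real.exp 1 := by linarith [Real.exp_one_gt_d9]
  have hL0 : 0 < L := by linarith
  have heq : Real.exp 1 / (Real.exp 1 - 1) * (1 - 1 / L) =
      Real.exp 1 * (L - 1) / ((Real.exp 1 - 1) * L) := by
    have : Real.exp 1 - 1 ≠ 0 := by linarith
    field_simp
  rw [fKT, Real.log_exp, heq, div_le_div_iff₀ (mul_pos (by linarith) hL0) (mul_pos hpos hL0)]
  have h : 0 ≤ Real.exp 1 * (L - 1) * L :=
    mul_nonneg (mul_nonneg (by linarith) (by linarith)) hL0.le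
  linarith

/-- The denominator of `f(x,t)` is positive and
`sup { f(x,t) : x ≥ e⁴, t ∈ (0,1] } = e/(e-1)`. -/
theorem fKT_sup :
    (∀ x t : ℝ, Real.exp 4 ≤ x → 0 < t → t ≤ 1 →
      0 < Real.exp t * (Real.log x - t) - Real.log x) ∧
    sSup {y : ℝ | ∃ x t : ℝ, Real.exp 4 ≤ x ∧ 0 < t ∧ t ≤ 1 ∧ y = fKT x t} =
      Real.exp 1 / (Real.exp 1 - 1) := by
  have hlog : ∀ x : ℝ, Real.exp 4 ≤ x → 4 ≤ Real.log x := fun x hx =>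
    (Real.le_log_iff_exp_le ((Real.exp_pos 4).trans_le hx)).2 hx
  refine ⟨fun x t hx h0 h1 => exp_mul_sub_sub_pos (hlog x hx) h0 h1, ?_⟩
  apply csSup_eq_of_forall_le_of_forall_lt_exists_gt
  · exact ⟨_, Real.exp 4, 1, le_rfl, one_pos, le_rfl, rfl⟩
  · rintro _ ⟨x, t, hx, h0, h1, rfl⟩
    exact fKT_le (hlog x hx) h0 h1
  · intro w hw
    have hlim : Filter.Tendsto (fun L : ℝ => Real.exp 1 / (Real.exp 1 - 1) * (1 - 1 / L))
        Filter.atTop (nhds (Real.exp 1 / (Real.exp 1 - 1))) := by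
      simpa using ((tendsto_inv_atTop_zero (𝕜 := ℝ)).const_sub 1).const_mul
        (Real.exp 1 / (Real.exp 1 - 1))
    obtain ⟨L, hwL, hL⟩ :=
      ((hlim.eventually_const_lt hw).and (Filter.eventually_ge_atTop 4)).exists
    exact ⟨_, ⟨Real.exp L, 1, Real.exp_le_exp.2 hL, one_pos, le_rfl, rfl⟩,
      hwL.trans_le (le_fKT_exp_one hL)⟩
end
end

section
/- For every real y ≥ 4 and every t ∈ (0,1], one has (e^t − (t+1))·y² − t·(2e^t − (t+2))·y + e^t·t² ≥ 0. -/
/-- The quadratic inequality from the proof of Lemma 4.5. -/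
theorem quadratic_inequality :
    ∀ y t : ℝ, 4 ≤ y → 0 < t → t ≤ 1 →
    0 ≤ (Real.exp t - (t + 1)) * y ^ 2 - t * (2 * Real.exp t - (t + 2)) * y +
      Real.exp t * t ^ 2 := by
  intro y t _ ht _
  have hexp : 0 ≤ Real.exp t - (1 + t + t ^ 2 / 2) :=
    sub_nonneg.mpr (Real.quadratic_le_exp_of_nonneg ht.le)
  calc
    0 ≤ (Real.exp t - (1 + t + t ^ 2 / 2)) * (y - t) ^ 2 +
        t ^ 2 / 2 * ((y - t - 1) ^ 2 + 1) := by positivity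
    _ = _ := by ring
end

section
/- Let m, m′ ≥ 1 be integers, let Q ≥ 3 and K > 0 be real, and let x ≥ 3. Define η(x) = inf_{t ≥ 3} ( K·log x/((m+m′)·log(Q·t^m)) + log t ). Then e^{−η(x)} ≤ exp( −K·log x/((m+m′)·log Q + √(m·(m+m′)·K·log x)) ). -/
noncomputable section

/-- The lower bound for a single `t`, with `u = log t`, `q = log Q` and `A = K log x`. -/
theorem div_add_sqrt_le_div_add {m M q A u : ℝ} (hm : 0 < m) (hM : 0 < M) (hq : 0 < q)
    (hA : 0 < A) (hu : 0 ≤ u) :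
    A / (M * q + Real.sqrt (m * M * A)) ≤ A / (M * (q + m * u)) + u := by
  have hS : 0 < Real.sqrt (m * M * A) := Real.sqrt_pos.mpr (by positivity)
  have hS2 : Real.sqrt (m * M * A) ^ 2 = m * M * A := Real.sq_sqrt (by positivity)
  set S := Real.sqrt (m * M * A)
  rcases le_total (M * (m * u)) S with h | h
  · have : A / (M * q + S) ≤ A / (M * (q + m * u)) := by
      gcongr
      linarith
    linarith
  · have h_large : A / (M * q + S) ≤ u := by
      rw [div_le_iff₀ (by positivity)]
      have h_mul : m * M * A ≤ m * M * (u * S) := by nlinarith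
      have : A ≤ u * S := le_of_mul_le_mul_left h_mul (by positivity)
      have : 0 ≤ u * (M * q) := by positivity
      linarith
    have : 0 ≤ A / (M * (q + m * u)) := by positivity
    linarith

/-- **Lemma 6.1** (optimizing over the standard zero-free region). -/
theorem eta_bound_standard_region :
    ∀ (m m' : ℕ) (Q K x : ℝ), 1 ≤ m → 1 ≤ m' → 3 ≤ Q → 0 < K → 3 ≤ x →
    Real.exp (-(⨅ t : {t : ℝ // 3 ≤ t},
        (K * Real.log x / (((m : ℝ) + (m' : ℝ)) * Real.log (Q * (t : ℝ) ^ (m : ℕ))) +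
          Real.log (t : ℝ)))) ≤
      Real.exp (-(K * Real.log x / (((m : ℝ) + (m' : ℝ)) * Real.log Q +
        Real.sqrt ((m : ℝ) * ((m : ℝ) + (m' : ℝ)) * K * Real.log x)))) := by
  intro m m' Q K x hm hm' hQ hK hx
  rw [Real.exp_le_exp, neg_le_neg_iff]
  have : Nonempty {t : ℝ // 3 ≤ t} := ⟨⟨3, le_rfl⟩⟩
  refine le_ciInf fun ⟨t, ht⟩ => ?_
  have hm0 : (0 : ℝ) < m := by exact_mod_cast hm
  have hlogx : 0 < Real.log x := Real.log_pos (by linarith)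
  have hlogQ : 0 < Real.log Q := Real.log_pos (by linarith)
  have hlogt : 0 ≤ Real.log t := Real.log_nonneg (by linarith)
  have hlog : Real.log (Q * t ^ m) = Real.log Q + m * Real.log t := by
    rw [Real.log_mul (by positivity) (by positivity), Real.log_pow]
  simpa only [hlog, mul_assoc] using
    div_add_sqrt_le_div_add (M := (m : ℝ) + m') hm0 (by positivity) hlogQ
      (mul_pos hK hlogx) hlogt
end
end

section
/- For x ≥ e⁴ and t ∈ (0,1], define f(x,t) = e^t·t·(log x − t)·(log x − 1)/((e^t·(log x − t) − log x)·log x). For each fixed x ≥ e⁴, the function t ↦ f(x,t) is monotonically increasing on (0,1]; moreover lim_{t→0⁺} f(x,t) = 1, f(x,1) = e·(log x − 1)²/(((e−1)·log x − e)·log x), and 1 ≤ e·(log x − 1)²/(((e−1)·log x − e)·log x). -/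
noncomputable section

/-- The function `t ↦ L e⁻ᵗ / (L - t)` is log-convex, hence convex, on `[0,1]` when `1 < L`. -/
theorem convexOn_mul_exp_neg_div_sub {L : ℝ} (hL : 1 < L) :
    ConvexOn ℝ (Set.Icc 0 1) (fun t : ℝ => L * Real.exp (-t) / (L - t)) := by
  have key : ∀ t ∈ Set.Icc (0 : ℝ) 1,
      L * Real.exp (-t) / (L - t) = L * Real.exp (-t - Real.log (L - t)) := by
    intro t ht
    rw [Real.exp_sub, Real.exp_log (by linarith [ht.2]), mul_div_assoc]
  refine ⟨convex_Icc 0 1, fun u hu v hv a b ha hb hab => ?_⟩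
  have hmem := convex_Icc (0 : ℝ) 1 hu hv ha hb hab
  have hlog := strictConcaveOn_log_Ioi.concaveOn.2 (x := L - u) (y := L - v)
    (by simp only [Set.mem_Ioi]; linarith [hu.2]) (by simp only [Set.mem_Ioi]; linarith [hv.2])
    ha hb hab
  have hexp := convexOn_exp.2 (Set.mem_univ (-u - Real.log (L - u)))
    (Set.mem_univ (-v - Real.log (L - v))) ha hb hab
  simp only [smul_eq_mul] at hmem hlog hexp ⊢
  rw [key _ hmem, key u hu, key v hv]
  have hsub : a * (L - u) + b * (L - v) = L - (a * u + b * v) := by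
    linear_combination L * hab
  rw [hsub] at hlog
  have hle : Real.exp (-(a * u + b * v) - Real.log (L - (a * u + b * v))) ≤
      a * Real.exp (-u - Real.log (L - u)) + b * Real.exp (-v - Real.log (L - v)) :=
    (Real.exp_le_exp.2 (by linarith)).trans hexp
  calc _ ≤ L * (a * Real.exp (-u - Real.log (L - u)) + b * Real.exp (-v - Real.log (L - v))) :=
        mul_le_mul_of_nonneg_left hle (by linarith)
    _ = _ := by ring

/-- `fKT x t` in terms of the secant slope at `0` of `t ↦ L e⁻ᵗ / (L - t)`, `L = log x`. -/
theorem fKT_eq_inv_slope {x t : ℝ} (hL : 1 < Real.log x) (ht : t ∈ Set.Ioc (0 : ℝ) 1) :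
    fKT x t = (Real.log x - 1) / Real.log x *
      (-slope (fun s : ℝ => Real.log x * Real.exp (-s) / (Real.log x - s)) 0 t)⁻¹ := by
  rw [fKT, slope_def_field]
  generalize Real.log x = L at hL ⊢
  have hLt : L - t ≠ 0 := by linarith [ht.2]
  have hL0 : L ≠ 0 := by linarith
  have ht0 : t ≠ 0 := ht.1.ne'
  have he : Real.exp t ≠ 0 := Real.exp_ne_zero t
  have hs : -((L * Real.exp (-t) / (L - t) - L * Real.exp (-0) / (L - 0)) / (t - 0)) =
      (Real.exp t * (L - t) - L) / (Real.exp t * t * (L - t)) := by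
    rw [Real.exp_neg]
    simp only [neg_zero, Real.exp_zero, sub_zero, mul_one, div_self hL0]
    field_simp
    ring
  rw [hs, inv_div, div_mul_div_comm]
  congr 1 <;> ring

/-- Monotonicity and limiting behaviour of `t ↦ f(x,t)` on `(0,1]`. -/
theorem fKT_monotone :
    ∀ x : ℝ, Real.exp 4 ≤ x →
    MonotoneOn (fun t => fKT x t) (Set.Ioc 0 1) ∧
    Filter.Tendsto (fun t => fKT x t) (nhdsWithin 0 (Set.Ioi 0)) (nhds 1) ∧
    fKT x 1 = Real.exp 1 * (Real.log x - 1) ^ 2 /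
      (((Real.exp 1 - 1) * Real.log x - Real.exp 1) * Real.log x) ∧
    1 ≤ Real.exp 1 * (Real.log x - 1) ^ 2 /
      (((Real.exp 1 - 1) * Real.log x - Real.exp 1) * Real.log x) := by
  intro x hx
  have hL : 4 ≤ Real.log x := by
    simpa using Real.log_le_log (Real.exp_pos 4) hx
  have he1 := Real.exp_one_gt_d9
  have he2 := Real.exp_one_lt_d9
  refine ⟨?_, ?_, ?_, ?_⟩
  · have hconv := convexOn_mul_exp_neg_div_sub (L := Real.log x) (by linarith)
    have hmono : ∀ s ∈ Set.Ioc (0 : ℝ) 1, ∀ t ∈ Set.Ioc (0 : ℝ) 1, s ≤ t →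
        slope (fun s : ℝ => Real.log x * Real.exp (-s) / (Real.log x - s)) 0 s ≤
          slope (fun s : ℝ => Real.log x * Real.exp (-s) / (Real.log x - s)) 0 t := by
      intro s hs t ht hst
      rw [slope_def_field, slope_def_field]
      exact hconv.secant_mono (by simp) ⟨hs.1.le, hs.2⟩ ⟨ht.1.le, ht.2⟩ hs.1.ne' ht.1.ne' hst
    have hneg : slope (fun s : ℝ => Real.log x * Real.exp (-s) / (Real.log x - s)) 0 1 < 0 := by
      rw [slope_def_field, Real.exp_neg]
      generalize Real.log x = L at hL ⊢
      have hL0 : L ≠ 0 := by linarith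
      simp only [neg_zero, Real.exp_zero, sub_zero, mul_one, div_self hL0, div_one, sub_neg]
      rw [div_lt_one (by linarith), mul_inv_lt_iff₀ (Real.exp_pos 1)]
      nlinarith
    intro s hs t ht hst
    simp only [fKT_eq_inv_slope (by linarith) hs, fKT_eq_inv_slope (by linarith) ht]
    refine mul_le_mul_of_nonneg_left (inv_anti₀ ?_ ?_) (div_nonneg (by linarith) (by linarith))
    · linarith [hmono t ht 1 (by simp) ht.2]
    · linarith [hmono s hs t ht hst]
  · have hL0 : Real.log x ≠ 0 := by linarith
    have hL1 : Real.log x - 1 ≠ 0 := by linarith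
    have hderiv : HasDerivAt (fun s : ℝ => Real.log x * Real.exp (-s) / (Real.log x - s))
        (-((Real.log x - 1) / Real.log x)) 0 := by
      have h := (((hasDerivAt_id (0 : ℝ)).neg.exp).const_mul (Real.log x)).div
        ((hasDerivAt_id (0 : ℝ)).const_sub (Real.log x)) (by simpa using hL0)
      refine h.congr_deriv ?_
      simp
      field_simp
      ring
    have hslope := (hasDerivAt_iff_tendsto_slope.1 hderiv).mono_left
      (nhdsWithin_mono 0 (fun t (ht : 0 < t) => ht.ne') :
        nhdsWithin (0 : ℝ) (Set.Ioi 0) ≤ nhdsWithin 0 {0}ᶜ)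
    have hlim := (hslope.neg.inv₀ (by rw [neg_neg]; exact div_ne_zero hL1 hL0)).const_mul
      ((Real.log x - 1) / Real.log x)
    rw [neg_neg, mul_inv_cancel₀ (div_ne_zero hL1 hL0)] at hlim
    refine hlim.congr' ?_
    filter_upwards [Ioc_mem_nhdsGT (zero_lt_one' ℝ)] with t ht
    exact (fKT_eq_inv_slope (by linarith) ht).symm
  · rw [fKT]
    congr 1 <;> ring
  · rw [one_le_div (mul_pos (by nlinarith) (by linarith))]
    nlinarith
end
end
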